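/- Let k be a field and k[t] the graded polynomial algebra with a generator t in homological degree n-1 (n ≥ 2). Then every dg-module over k[t] whose total homology is finite dimensional over k lies in the smallest stable (triangulated) subcategory of the derived category D(k[t]) containing the trivial module k (the module with homology k on which t acts by zero). -/

import Mathlib

/-!
STATEMENT 0: Let k be a field and k[t] the graded polynomial algebra with a
generator t in homological degree n-1 (n ≥ 2).  Then every dg-module over k[t]
whose total homology is finite dimensional over k lies in the smallest stable
(triangulated) subcategory of the derived category D(k[t]) containing the trivial
module k (the module with homology k on which t acts by zero).

We model dg-modules over k[t_{n-1}] concretely, and the smallest stable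
subcategory containing k as the smallest class of dg-modules containing the
trivial module and closed under quasi-isomorphism, vanishing of acyclics, and
two-out-of-three for degreewise short exact sequences (which realize the
distinguished triangles of the derived category).
-/

namespace Stmt0

variable (k : Type) [Field k] (m : ℤ)

/-- A dg-module over the graded polynomial algebra `k[t]` with `|t| = m` and zero
differential on the algebra: a ℤ-graded `k`-module with a square-zero differential
`d` of degree `-1` and a degree-`m` operator `t` satisfying the graded Leibniz rule
`d ∘ t = (-1)^m t ∘ d`. -/
structure DGMod where
  M : ℤ → Type
  [acg : ∀ i, AddCommGroup (M i)]
  [mod : ∀ i, Module k (M i)]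
  d : ∀ i : ℤ, M (i + 1) →ₗ[k] M i
  t : ∀ i : ℤ, M i →ₗ[k] M (i + m)
  dsq : ∀ (i : ℤ) (x : M (i + 1 + 1)), d i (d (i + 1) x) = 0
  dt : ∀ (i : ℤ) (x : M (i + 1)),
    d (i + m) (cast (congrArg M (by ring : i + 1 + m = i + m + 1)) (t (i + 1) x))
      = ((-1 : k) ^ m) • t i (d i x)

attribute [instance] DGMod.acg DGMod.mod

variable {k m}

/-- Transport along an equality of degrees. -/
def DGMod.c (X : DGMod k m) {i j : ℤ} (h : i = j) : X.M i →ₗ[k] X.M j := by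
  subst h; exact LinearMap.id

/-- A morphism of dg-modules. -/
structure DGHom (X Y : DGMod k m) where
  φ : ∀ i : ℤ, X.M i →ₗ[k] Y.M i
  comm_d : ∀ (i : ℤ) (x : X.M (i + 1)), φ i (X.d i x) = Y.d i (φ (i + 1) x)
  comm_t : ∀ (i : ℤ) (x : X.M i), φ (i + m) (X.t i x) = Y.t i (φ i x)

/-- A degreewise short exact sequence of dg-modules. -/
def IsSES {A B C : DGMod k m} (f : DGHom A B) (g : DGHom B C) : Prop :=
  ∀ i : ℤ, Function.Injective (f.φ i) ∧ Function.Surjective (g.φ i) ∧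
    ∀ x : B.M i, g.φ i x = 0 ↔ ∃ a : A.M i, f.φ i a = x

/-- A quasi-isomorphism of dg-modules. -/
def IsQIso {X Y : DGMod k m} (φ : DGHom X Y) : Prop :=
  (∀ (i : ℤ) (y : Y.M (i + 1)), Y.d i y = 0 →
    ∃ (x : X.M (i + 1)) (z : Y.M (i + 1 + 1)),
      X.d i x = 0 ∧ φ.φ (i + 1) x = y + Y.d (i + 1) z) ∧
  (∀ (i : ℤ) (x : X.M (i + 1)), X.d i x = 0 →
    (∃ z : Y.M (i + 1 + 1), φ.φ (i + 1) x = Y.d (i + 1) z) →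
    ∃ w : X.M (i + 1 + 1), x = X.d (i + 1) w)

/-- An acyclic dg-module. -/
def IsAcyclic (X : DGMod k m) : Prop :=
  ∀ (i : ℤ) (x : X.M (i + 1)), X.d i x = 0 → ∃ y : X.M (i + 1 + 1), X.d (i + 1) y = x

/-- The homology of `X` sitting in degree `i + 1`. -/
abbrev Hgy (X : DGMod k m) (i : ℤ) :=
  ↥(LinearMap.ker (X.d i)) ⧸
    (Submodule.comap (LinearMap.ker (X.d i)).subtype (LinearMap.range (X.d (i + 1))))

/-- `X` has finite dimensional total homology. -/
def FinHomology (X : DGMod k m) : Prop :=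
  (∀ i : ℤ, FiniteDimensional k (Hgy X i)) ∧
  ∃ N : ℕ, ∀ i : ℤ, (N : ℤ) ≤ |i| →
    ∀ x : X.M (i + 1), X.d i x = 0 → ∃ y : X.M (i + 1 + 1), X.d (i + 1) y = x

/-- `X` is (isomorphic to) the trivial dg-module `k`: one-dimensional, concentrated
in degree `0`, with zero differential and `t` acting by zero. -/
def IsTrivialK (X : DGMod k m) : Prop :=
  Nonempty (X.M 0 ≃ₗ[k] k) ∧ (∀ i : ℤ, i ≠ 0 → ∀ x : X.M i, x = 0) ∧
  (∀ (i : ℤ) (x : X.M (i + 1)), X.d i x = 0) ∧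
  (∀ (i : ℤ) (x : X.M i), X.t i x = 0)

/-- The smallest class of dg-modules containing the trivial module `k`, closed under
quasi-isomorphism (in both directions, including vanishing of acyclic modules) and
under two-out-of-three for degreewise short exact sequences of dg-modules.  This is
the concrete incarnation of the smallest stable (triangulated) subcategory of the
derived category `D(k[t])` containing the trivial module. -/
inductive Gen : DGMod k m → Prop
  | triv (X : DGMod k m) : IsTrivialK X → Gen X
  | acyclic (X : DGMod k m) : IsAcyclic X → Gen X
  | qiso_fwd {X Y : DGMod k m} (φ : DGHom X Y) : IsQIso φ → Gen X → Gen Y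
  | qiso_bwd {X Y : DGMod k m} (φ : DGHom X Y) : IsQIso φ → Gen Y → Gen X
  | ext_mid {A B C : DGMod k m} (f : DGHom A B) (g : DGHom B C) :
      IsSES f g → Gen A → Gen C → Gen B
  | ext_left {A B C : DGMod k m} (f : DGHom A B) (g : DGHom B C) :
      IsSES f g → Gen B → Gen C → Gen A
  | ext_right {A B C : DGMod k m} (f : DGHom A B) (g : DGHom B C) :
      IsSES f g → Gen A → Gen B → Gen C

section Helpers

/-- A family of modules, seen as a dg-module with zero differential and zero `t`. -/
def Sg (m : ℤ) (V : ℤ → Type) [∀ i, AddCommGroup (V i)] [∀ i, Module k (V i)] : DGMod k m where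
  M := V
  d := fun _ => 0
  t := fun _ => 0
  dsq := by intros; rfl
  dt := by intros; simp

theorem cast_zero_fam (V : ℤ → Type) [∀ i, AddCommGroup (V i)] {i j : ℤ} (h : i = j)
    (hh : V i = V j) : cast hh (0 : V i) = 0 := by
  subst h; rfl

/-- The acyclic extension of `Sg V` by its shift. -/
def Ext (m : ℤ) (V : ℤ → Type) [∀ i, AddCommGroup (V i)] [∀ i, Module k (V i)] : DGMod k m where
  M := fun i => V i × V (i + 1)
  d := fun i => (LinearMap.inr k (V i) (V (i + 1))).comp
    (LinearMap.fst k (V (i + 1)) (V (i + 1 + 1)))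
  t := fun _ => 0
  dsq := by intros; simp
  dt := fun i x => by
    have := cast_zero_fam (fun i => V i × V (i + 1)) (show i + 1 + m = i + m + 1 by ring)
      (by congr 2 <;> ring)
    rw [LinearMap.zero_apply, this]
    simp

theorem ext_acyclic (V : ℤ → Type) [∀ i, AddCommGroup (V i)] [∀ i, Module k (V i)] :
    IsAcyclic (Ext (k := k) m V) := by
  rintro i ⟨x, y⟩ h
  have hx : x = 0 := congrArg Prod.snd h
  subst hx
  exact ⟨(y, 0), rfl⟩

def extInl (V : ℤ → Type) [∀ i, AddCommGroup (V i)] [∀ i, Module k (V i)] :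
    DGHom (Sg (k := k) m (fun i => V (i + 1))) (Ext (k := k) m V) where
  φ := fun i => LinearMap.inr k (V i) (V (i + 1))
  comm_d := fun _ _ => rfl
  comm_t := fun _ _ => rfl

def extFst (V : ℤ → Type) [∀ i, AddCommGroup (V i)] [∀ i, Module k (V i)] :
    DGHom (Ext (k := k) m V) (Sg (k := k) m V) where
  φ := fun i => LinearMap.fst k (V i) (V (i + 1))
  comm_d := fun _ _ => rfl
  comm_t := fun _ _ => rfl

theorem ext_ses (V : ℤ → Type) [∀ i, AddCommGroup (V i)] [∀ i, Module k (V i)] :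
    IsSES (extInl (k := k) (m := m) V) (extFst (k := k) (m := m) V) := by
  intro i
  refine ⟨LinearMap.inr_injective (R := k) (M := V i) (M₂ := V (i + 1)),
    LinearMap.fst_surjective (R := k) (M := V i) (M₂ := V (i + 1)), ?_⟩
  rintro ⟨x, y⟩
  constructor
  · intro h
    have hx : x = 0 := h
    subst hx
    exact ⟨y, rfl⟩
  · rintro ⟨a, ha⟩
    exact (congrArg Prod.fst ha).symm

theorem gen_shift_iff (V : ℤ → Type) [∀ i, AddCommGroup (V i)] [∀ i, Module k (V i)] :
    Gen (Sg (k := k) m V) ↔ Gen (Sg (k := k) m (fun i => V (i + 1))) :=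
  ⟨fun h => Gen.ext_left _ _ (ext_ses V) (Gen.acyclic _ (ext_acyclic V)) h,
   fun h => Gen.ext_right _ _ (ext_ses V) h (Gen.acyclic _ (ext_acyclic V))⟩

theorem gen_of_equiv (V W : ℤ → Type) [∀ i, AddCommGroup (V i)] [∀ i, Module k (V i)]
    [∀ i, AddCommGroup (W i)] [∀ i, Module k (W i)] (e : ∀ i, V i ≃ₗ[k] W i)
    (h : Gen (Sg (k := k) m V)) : Gen (Sg (k := k) m W) := by
  let φ : DGHom (Sg (k := k) m V) (Sg (k := k) m W) :=
    { φ := fun i => (e i).toLinearMap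
      comm_d := fun i _ => map_zero (e i)
      comm_t := fun i _ => map_zero (e (i + m)) }
  refine Gen.qiso_fwd φ ⟨?_, ?_⟩ h
  · intro i y _
    refine ⟨(e (i + 1)).symm y, 0, rfl, ?_⟩
    rw [map_zero, add_zero]
    exact (e (i + 1)).apply_symm_apply y
  · rintro i x _ ⟨z, hz⟩
    refine ⟨0, ?_⟩
    have h0 : e (i + 1) x = 0 := hz
    have h1 : x = (0 : V (i + 1)) := (e (i + 1)).map_eq_zero_iff.1 h0
    rw [map_zero]
    exact h1

def castE (V : ℤ → Type) [∀ i, AddCommGroup (V i)] [∀ i, Module k (V i)] {i j : ℤ} (h : i = j) :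
    V i ≃ₗ[k] V j := by
  subst h; exact LinearEquiv.refl k _

theorem gen_rank_one (a : ℤ) : ∀ (V : ℤ → Type) [∀ i, AddCommGroup (V i)] [∀ i, Module k (V i)],
    (∀ i, i ≠ a → ∀ x : V i, x = 0) → Module.finrank k (V a) = 1 → Gen (Sg (k := k) m V) := by
  induction a using Int.induction_on with
  | zero =>
    intro V _ _ h0 h1
    have : Module.Finite k (V 0) := Module.finite_of_finrank_eq_succ h1
    have e : V 0 ≃ₗ[k] k := LinearEquiv.ofFinrankEq (V 0) k (by simp [h1])
    exact Gen.triv _ ⟨⟨e⟩, h0, fun _ _ => rfl, fun _ _ => rfl⟩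
  | succ a ih =>
    intro V _ _ h0 h1
    rw [gen_shift_iff]
    exact ih _ (fun i hi => h0 _ (by omega)) h1
  | pred a ih =>
    intro V _ _ h0 h1
    have h := ih (fun i => V (i - 1)) (fun i hi => h0 _ (by omega)) h1
    rw [gen_shift_iff] at h
    exact gen_of_equiv _ _ (fun i => castE V (by ring)) h

theorem gen_conc (a : ℤ) (r : ℕ) : ∀ (V : ℤ → Type) [∀ i, AddCommGroup (V i)]
    [∀ i, Module k (V i)], (∀ i, i ≠ a → ∀ x : V i, x = 0) → Module.Finite k (V a) →
    Module.finrank k (V a) = r → Gen (Sg (k := k) m V) := by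
  induction r with
  | zero =>
    intro V _ _ h0 hf h1
    refine Gen.acyclic _ ?_
    intro i x _
    refine ⟨0, ?_⟩
    rw [map_zero]
    by_cases h : i + 1 = a
    · subst h
      have := Module.finrank_zero_iff.1 h1
      exact Subsingleton.elim (α := V (i + 1)) _ _
    · exact (h0 _ h x).symm
  | succ r ih =>
    intro V _ _ h0 hf h1
    have : Nontrivial (V a) := Module.nontrivial_of_finrank_pos (R := k) (by omega)
    obtain ⟨v, hv⟩ := exists_ne (0 : V a)
    let w : ∀ i, V i := Pi.single a v
    have hw : w a = v := Pi.single_eq_same a v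
    let W : ∀ i, Submodule k (V i) := fun i => Submodule.span k {w i}
    have hW1 : Module.finrank k (W a) = 1 := 
      finrank_span_singleton (by rw [hw]; exact hv)
    let f : DGHom (Sg (k := k) m (fun i => W i)) (Sg (k := k) m V) :=
      { φ := fun i => (W i).subtype
        comm_d := fun i _ => map_zero (W i).subtype
        comm_t := fun i _ => map_zero (W (i + m)).subtype }
    let g : DGHom (Sg (k := k) m V) (Sg (k := k) m (fun i => V i ⧸ W i)) :=
      { φ := fun i => (W i).mkQ
        comm_d := fun i _ => map_zero (W i).mkQ
        comm_t := fun i _ => map_zero (W (i + m)).mkQ }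
    refine Gen.ext_mid f g ?_ (gen_rank_one a _ ?_ hW1) (ih _ ?_ inferInstance ?_)
    · intro i
      refine ⟨Subtype.val_injective, Submodule.mkQ_surjective _, fun x => ?_⟩
      refine (Submodule.Quotient.mk_eq_zero (W i)).trans ?_
      exact ⟨fun h => ⟨⟨x, h⟩, rfl⟩, fun ⟨y, hy⟩ => hy ▸ y.2⟩
    · intro i hi x
      exact Subtype.ext (h0 i hi x.1)
    · intro i hi x
      obtain ⟨y, rfl⟩ := Submodule.mkQ_surjective _ x
      rw [h0 i hi y, map_zero]
    · have := Submodule.finrank_quotient_add_finrank (W a)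
      omega

theorem sub_cast (X : DGMod k m) (N : ∀ i, Submodule k (X.M i)) {i j : ℤ} (h : i = j)
    (hh : (N i : Type) = N j) (x : N i) :
    ((cast hh x : N j) : X.M j) = cast (congrArg X.M h) x.1 := by
  subst h; rfl

/-- A dg-submodule as a dg-module. -/
def Sub (X : DGMod k m) (N : ∀ i, Submodule k (X.M i))
    (hd : ∀ i, ∀ x ∈ N (i + 1), X.d i x ∈ N i) (ht : ∀ i, ∀ x ∈ N i, X.t i x ∈ N (i + m)) :
    DGMod k m where
  M := fun i => N i
  d := fun i => (X.d i).restrict (hd i)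
  t := fun i => (X.t i).restrict (ht i)
  dsq := fun i x => Subtype.ext (X.dsq i x.1)
  dt := fun i x => by
    apply Subtype.ext
    have h := X.dt i x.1
    rw [← sub_cast X N (by ring) (congrArg (fun i => (N i : Type)) (by ring)) ⟨X.t (i + 1) x.1, ht _ _ x.2⟩] at h
    exact h

/-- Cycles. -/
def cyc (X : DGMod k m) (i : ℤ) : Submodule k (X.M i) where
  carrier := {x | ∀ (j : ℤ) (h : i = j + 1), X.d j (X.c h x) = 0}
  add_mem' := fun hx hy j h => by rw [map_add, map_add, hx, hy, add_zero]
  zero_mem' := fun j h => by rw [map_zero, map_zero]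
  smul_mem' := fun r x hx j h => by rw [map_smul, map_smul, hx, smul_zero]

theorem mem_cyc (X : DGMod k m) (i : ℤ) (x : X.M (i + 1)) : x ∈ cyc X (i + 1) ↔ X.d i x = 0 := by
  constructor
  · intro h
    exact h i rfl
  · intro h j hj
    obtain rfl : i = j := by omega
    exact h

theorem d_mem_cyc (X : DGMod k m) (i : ℤ) (x : X.M (i + 1)) : X.d i x ∈ cyc X i := by
  intro j h
  subst h
  exact X.dsq j x

def T (X : DGMod k m) (a i : ℤ) : Submodule k (X.M i) where
  carrier := {x | (i < a → x = 0) ∧ (i = a → x ∈ cyc X i)}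
  add_mem' := fun hx hy => ⟨fun h => by rw [hx.1 h, hy.1 h, add_zero],
    fun h => add_mem (hx.2 h) (hy.2 h)⟩
  zero_mem' := ⟨fun _ => rfl, fun _ => zero_mem _⟩
  smul_mem' := fun r x hx => ⟨fun h => by rw [hx.1 h, smul_zero],
    fun h => Submodule.smul_mem _ r (hx.2 h)⟩

def U (X : DGMod k m) (a i : ℤ) : Submodule k (X.M i) where
  carrier := {x | (i < a → x = 0) ∧ (i = a → x ∈ LinearMap.range (X.d i))}
  add_mem' := fun hx hy => ⟨fun h => by rw [hx.1 h, hy.1 h, add_zero],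
    fun h => add_mem (hx.2 h) (hy.2 h)⟩
  zero_mem' := ⟨fun _ => rfl, fun _ => zero_mem _⟩
  smul_mem' := fun r x hx => ⟨fun h => by rw [hx.1 h, smul_zero],
    fun h => Submodule.smul_mem _ r (hx.2 h)⟩

theorem U_le_T (X : DGMod k m) (a i : ℤ) : U X a i ≤ T X a i := by
  intro x hx
  refine ⟨hx.1, fun h => ?_⟩
  obtain ⟨y, rfl⟩ := hx.2 h
  exact d_mem_cyc X i y

theorem T_d (X : DGMod k m) (a i : ℤ) (x : X.M (i + 1)) (hx : x ∈ T X a (i + 1)) :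
    X.d i x ∈ U X a i := by
  refine ⟨fun h => ?_, fun _ => ⟨x, rfl⟩⟩
  rcases lt_or_eq_of_le (show i + 1 ≤ a by omega) with h1 | h1
  · rw [hx.1 h1, map_zero]
  · exact (mem_cyc X i x).1 (hx.2 h1)

theorem T_t (hm : 1 ≤ m) (X : DGMod k m) (a i : ℤ) (x : X.M i) (hx : x ∈ T X a i) :
    X.t i x ∈ U X a (i + m) := by
  by_cases h : i < a
  · rw [hx.1 h, map_zero]
    exact zero_mem _
  · exact ⟨fun h1 => by omega, fun h1 => by omega⟩

def TM (hm : 1 ≤ m) (X : DGMod k m) (a : ℤ) : DGMod k m :=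
  Sub X (T X a) (fun i x hx => U_le_T X a i (T_d X a i x hx))
    (fun i x hx => U_le_T X a _ (T_t hm X a i x hx))

def UM (hm : 1 ≤ m) (X : DGMod k m) (a : ℤ) : DGMod k m :=
  Sub X (U X a) (fun i x hx => T_d X a i x (U_le_T X a _ hx))
    (fun i x hx => T_t hm X a i x (U_le_T X a _ hx))

def incl (X : DGMod k m) {N NN : ∀ i, Submodule k (X.M i)} {hd ht hdd htt}
    (h : ∀ i, N i ≤ NN i) : DGHom (Sub X N hd ht) (Sub X NN hdd htt) where
  φ := fun i => Submodule.inclusion (h i)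
  comm_d := fun _ _ => rfl
  comm_t := fun _ _ => rfl

def inclX (X : DGMod k m) {N : ∀ i, Submodule k (X.M i)} {hd ht} : DGHom (Sub X N hd ht) X where
  φ := fun i => (N i).subtype
  comm_d := fun _ _ => rfl
  comm_t := fun _ _ => rfl

theorem T_succ_le_U (X : DGMod k m) (a i : ℤ) : T X (a + 1) i ≤ U X a i := by
  intro x hx
  refine ⟨fun h => hx.1 (by omega), fun h => ?_⟩
  rw [hx.1 (by omega)]
  exact zero_mem _

theorem mem_T_of_lt (X : DGMod k m) {a i : ℤ} (h : a < i) (x : X.M i) : x ∈ T X a i :=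
  ⟨fun h1 => by omega, fun h1 => by omega⟩

theorem mem_U_of_lt (X : DGMod k m) {a i : ℤ} (h : a < i) (x : X.M i) : x ∈ U X a i :=
  ⟨fun h1 => by omega, fun h1 => by omega⟩

theorem mem_T_of_cyc (X : DGMod k m) {a i : ℤ} (h : a ≤ i + 1) (x : X.M (i + 1))
    (hx : X.d i x = 0) : x ∈ T X a (i + 1) :=
  ⟨fun h1 => by omega, fun _ => (mem_cyc X i x).2 hx⟩

/-- `T (a+1) → U a` is a quasi-isomorphism. -/
theorem gen_U (hm : 1 ≤ m) (X : DGMod k m) (a : ℤ) (h : Gen (TM hm X (a + 1))) :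
    Gen (UM hm X a) := by
  refine Gen.qiso_fwd (incl X (T_succ_le_U X a)) ⟨?_, ?_⟩ h
  · rintro i ⟨y, hy⟩ h
    have h0 : X.d i y = 0 := congrArg Subtype.val h
    rcases lt_trichotomy (i + 1) a with h1 | h1 | h1
    · refine ⟨0, 0, map_zero _, Subtype.ext ?_⟩
      have := hy.1 h1
      rw [map_zero, map_zero]
      change 0 = y + 0
      rw [this, add_zero]
    · obtain ⟨w, hw⟩ := hy.2 h1
      refine ⟨0, ⟨-w, mem_U_of_lt X (by omega) _⟩, map_zero _, Subtype.ext ?_⟩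
      rw [map_zero]
      change 0 = y + X.d (i + 1) (-w)
      rw [map_neg, hw, add_neg_cancel]
    · refine ⟨⟨y, mem_T_of_cyc X (by omega) y h0⟩, 0, Subtype.ext h0, Subtype.ext ?_⟩
      rw [map_zero]
      exact (add_zero y).symm
  · rintro i ⟨x, hx⟩ h ⟨⟨z, hz⟩, hh⟩
    have h0 : x = X.d (i + 1) z := congrArg Subtype.val hh
    by_cases h1 : i + 1 < a + 1
    · refine ⟨0, Subtype.ext ?_⟩
      rw [map_zero]
      exact hx.1 h1
    · exact ⟨⟨z, mem_T_of_lt X (by omega) z⟩, Subtype.ext h0⟩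

theorem gen_X (hm : 1 ≤ m) (X : DGMod k m) (a : ℤ)
    (hex : ∀ i, i < a → ∀ x : X.M (i + 1), X.d i x = 0 → ∃ y, X.d (i + 1) y = x)
    (h : Gen (TM hm X a)) : Gen X := by
  refine Gen.qiso_fwd (inclX X) ⟨?_, ?_⟩ h
  · intro i y h0
    by_cases h1 : i + 1 < a
    · obtain ⟨w, hw⟩ := hex i (by omega) y h0
      refine ⟨0, -w, map_zero _, ?_⟩
      rw [map_zero, map_neg, hw, add_neg_cancel]
    · refine ⟨⟨y, mem_T_of_cyc X (by omega) y h0⟩, 0, Subtype.ext h0, ?_⟩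
      rw [map_zero, add_zero]
      rfl
  · rintro i ⟨x, hx⟩ h ⟨z, hh⟩
    have h0 : x = X.d (i + 1) z := hh
    by_cases h1 : i + 1 < a
    · refine ⟨0, Subtype.ext ?_⟩
      rw [map_zero]
      exact hx.1 h1
    · exact ⟨⟨z, mem_T_of_lt X (by omega) z⟩, Subtype.ext h0⟩

theorem gen_top (hm : 1 ≤ m) (X : DGMod k m) (a : ℤ)
    (hex : ∀ i, a ≤ i + 1 → ∀ x : X.M (i + 1), X.d i x = 0 → ∃ y, X.d (i + 1) y = x) :
    Gen (TM hm X a) := by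
  refine Gen.acyclic _ ?_
  rintro i ⟨x, hx⟩ h
  have h0 : X.d i x = 0 := congrArg Subtype.val h
  by_cases h1 : i + 1 < a
  · refine ⟨0, Subtype.ext ?_⟩
    rw [map_zero]
    exact (hx.1 h1).symm
  · obtain ⟨y, hy⟩ := hex i (by omega) x h0
    exact ⟨⟨y, mem_T_of_lt X (by omega) y⟩, Subtype.ext hy⟩

theorem gen_step (hm : 1 ≤ m) (X : DGMod k m) (a : ℤ)
    (hfin : ∀ i : ℤ, FiniteDimensional k (Hgy X i)) (h : Gen (TM hm X (a + 1))) :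
    Gen (TM hm X a) := by
  let Q : ∀ i, Submodule k (T X a i) := fun i => (U X a i).comap (T X a i).subtype
  let g : DGHom (TM hm X a) (Sg (k := k) m (fun i => (T X a i) ⧸ Q i)) :=
    { φ := fun i => (Q i).mkQ
      comm_d := fun i x => (Submodule.Quotient.mk_eq_zero (Q i)).2 (T_d X a i x.1 x.2)
      comm_t := fun i x => (Submodule.Quotient.mk_eq_zero (Q (i + m))).2 (T_t hm X a i x.1 x.2) }
  refine Gen.ext_mid (incl X (U_le_T X a)) g ?_ (gen_U hm X a h) (gen_conc a _ _ ?_ ?_ rfl)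
  · intro i
    refine ⟨Submodule.inclusion_injective (U_le_T X a i), Submodule.mkQ_surjective _, fun x => ?_⟩
    refine (Submodule.Quotient.mk_eq_zero (Q i)).trans ?_
    refine ⟨fun h => ⟨⟨x.1, h⟩, rfl⟩, ?_⟩
    rintro ⟨y, rfl⟩
    exact y.2
  · intro i hi x
    obtain ⟨⟨y, hy⟩, rfl⟩ := Submodule.mkQ_surjective _ x
    exact (Submodule.Quotient.mk_eq_zero (Q i)).2 ⟨hy.1, fun h => absurd h hi⟩
  · obtain ⟨i, rfl⟩ : ∃ i, a = i + 1 := ⟨a - 1, by ring⟩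
    have := hfin i
    have hle : LinearMap.ker (X.d i) ≤ T X (i + 1) (i + 1) := fun x hx =>
      mem_T_of_cyc X le_rfl x hx
    let F : Hgy X i →ₗ[k] (T X (i + 1) (i + 1) ⧸ Q (i + 1)) :=
      Submodule.liftQ _ ((Q (i + 1)).mkQ.comp (Submodule.inclusion hle)) (by
        intro x hx
        exact (Submodule.Quotient.mk_eq_zero (Q (i + 1))).2
          ⟨fun h => absurd h (lt_irrefl _), fun _ => hx⟩)
    refine Module.Finite.of_surjective F ?_
    intro x
    obtain ⟨⟨y, hy⟩, rfl⟩ := Submodule.mkQ_surjective _ x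
    exact ⟨Submodule.Quotient.mk ⟨y, (mem_cyc X i y).1 (hy.2 rfl)⟩, rfl⟩

theorem gen_all (hm : 1 ≤ m) (X : DGMod k m) (hX : FinHomology X) : Gen X := by
  obtain ⟨hfin, N, hN⟩ := hX
  have key : ∀ r : ℕ, Gen (TM hm X ((N : ℤ) + 1 - r)) := by
    intro r
    induction r with
    | zero =>
      exact gen_top hm X _ (fun i hi => hN i (le_trans (by push_cast at hi; omega) (le_abs_self i)))
    | succ r ih =>
      refine gen_step hm X _ hfin ?_
      have e : (N : ℤ) + 1 - ((r + 1 : ℕ) : ℤ) + 1 = (N : ℤ) + 1 - r := by push_cast; ring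
      rw [e]
      exact ih
  refine gen_X hm X _ (fun i hi => hN i ?_) (key (2 * N + 1))
  push_cast at hi
  exact le_trans (by omega) (neg_le_abs i)

end Helpers

theorem finite_homology_generated_by_trivial_module
    (k : Type) [Field k] (n : ℤ) (hn : 2 ≤ n)
    (X : DGMod k (n - 1)) (hX : FinHomology X) :
    Gen X := by
  exact gen_all (by omega) X hX

end Stmt0
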